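/- arXiv:2101.03739 — 9 statements merged into one kernel-verified Lean document; each statement's English description precedes it below -/
import Mathlib

section
/- The weak Pareto efficient solution set SOL^w(K_∞, f^∞) is empty if and only if 0 is not a weak Pareto efficient solution of f^∞ on K_∞ (i.e., SOL^w(K_∞, f^∞) = ∅ ⟺ 0 ∉ SOL^w(K_∞, f^∞)). -/
open Filter Topology MvPolynomial

/-- The asymptotic cone of a set `K ⊆ ℝⁿ`:
`K_∞ = {v : ∃ t_k → +∞, x_k ∈ K with x_k / t_k → v}`. -/
def asympCone {n : ℕ} (K : Set (Fin n → ℝ)) : Set (Fin n → ℝ) :=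
  {v | ∃ (t : ℕ → ℝ) (x : ℕ → (Fin n → ℝ)), (∀ k, x k ∈ K) ∧
    Tendsto t atTop atTop ∧ Tendsto (fun k => (t k)⁻¹ • x k) atTop (nhds v)}

/-- The weak Pareto efficient solution set of the vector function `p` on `C`:
`x* ∈ C` such that for no `x ∈ C` we have `p(x) - p(x*) ∈ -int ℝˢ₊`. -/
def SOLw {n s : ℕ} (C : Set (Fin n → ℝ)) (p : Fin s → (Fin n → ℝ) → ℝ) : Set (Fin n → ℝ) :=
  {x | x ∈ C ∧ ∀ y ∈ C, ¬ (∀ i, p i y < p i x)}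

/-- The Pareto efficient solution set of the vector function `p` on `C`:
`x* ∈ C` such that for no `x ∈ C` we have `p(x) - p(x*) ∈ -ℝˢ₊ \ {0}`. -/
def SOLs {n s : ℕ} (C : Set (Fin n → ℝ)) (p : Fin s → (Fin n → ℝ) → ℝ) : Set (Fin n → ℝ) :=
  {x | x ∈ C ∧ ∀ y ∈ C, ¬ ((∀ i, p i y ≤ p i x) ∧ (∃ i, p i y < p i x))}

/-- The set of global minimizers of the scalar function `q` on `C`. -/
def SOLmin {n : ℕ} (C : Set (Fin n → ℝ)) (q : (Fin n → ℝ) → ℝ) : Set (Fin n → ℝ) :=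
  {x | x ∈ C ∧ ∀ y ∈ C, q x ≤ q y}

/-- The recession polynomial (vector leading term) of `p`, as a function:
`p^∞(x) = lim_{λ→+∞} p(λx)/λ^{deg p}`, i.e. the evaluation of the homogeneous
component of `p` of top degree. -/
noncomputable def recFn {n : ℕ} (p : MvPolynomial (Fin n) ℝ) : (Fin n → ℝ) → ℝ :=
  fun x => eval x (homogeneousComponent p.totalDegree p)

/-- Evaluation of a polynomial, as a function `ℝⁿ → ℝ`. -/
noncomputable def evalFn {n : ℕ} (p : MvPolynomial (Fin n) ℝ) : (Fin n → ℝ) → ℝ :=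
  fun x => eval x p

/-- `⟨∇p^∞(x), y⟩`: the inner product of the gradient of the recession polynomial
of `p` at `x` with `y`. -/
noncomputable def gradRecInner {n : ℕ} (p : MvPolynomial (Fin n) ℝ) (x y : Fin n → ℝ) : ℝ :=
  ∑ j, (eval x (pderiv j (homogeneousComponent p.totalDegree p))) * y j

/-- `x` is a solution of the weak vector complementarity problem
`WVCP(C, ∇f^∞)`. -/
def isWVCPsol {n s : ℕ} (C : Set (Fin n → ℝ)) (f : Fin s → MvPolynomial (Fin n) ℝ)
    (x : Fin n → ℝ) : Prop :=
  x ∈ C ∧ (∀ y ∈ C, ¬ (∀ i, gradRecInner (f i) x y < 0)) ∧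
    ¬ (∀ i, 0 < gradRecInner (f i) x x)

theorem recFn_smul_aux {n : ℕ} (p : MvPolynomial (Fin n) ℝ) (c : ℝ) (x : Fin n → ℝ) :
    recFn p (c • x) = c ^ p.totalDegree * recFn p x := by
  unfold recFn
  have hh := homogeneousComponent_isHomogeneous p.totalDegree p
  generalize homogeneousComponent p.totalDegree p = q at hh
  rw [eval_eq, eval_eq, Finset.mul_sum]
  refine Finset.sum_congr rfl fun d hd => ?_
  have h1 : ∑ i ∈ d.support, d i = p.totalDegree := by
    have := hh (mem_support_iff.mp hd)
    rw [Finsupp.weight_apply] at this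
    simpa [Finsupp.sum] using this
  simp only [Pi.smul_apply, smul_eq_mul, mul_pow, Finset.prod_mul_distrib]
  rw [Finset.prod_pow_eq_pow_sum, h1]
  ring

theorem asympCone_smul_aux {n : ℕ} {K : Set (Fin n → ℝ)} {c : ℝ} (hc : 0 < c) {v : Fin n → ℝ}
    (hv : v ∈ asympCone K) : c • v ∈ asympCone K := by
  obtain ⟨t, x, hx, ht, hl⟩ := hv
  refine ⟨fun k => t k / c, x, hx, ht.atTop_div_const hc, ?_⟩
  refine (hl.const_smul c).congr fun k => ?_
  rw [smul_smul, inv_div, div_eq_mul_inv]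

theorem zero_mem_asympCone_aux {n : ℕ} {K : Set (Fin n → ℝ)} (hK : K.Nonempty) :
    (0 : Fin n → ℝ) ∈ asympCone K := by
  obtain ⟨a, ha⟩ := hK
  refine ⟨fun k => (k : ℝ), fun _ => a, fun _ => ha, tendsto_natCast_atTop_atTop, ?_⟩
  have h := (tendsto_inv_atTop_zero.comp (tendsto_natCast_atTop_atTop (R := ℝ))).smul_const a
  simpa using h

theorem stmt0 {n s : ℕ} (hs : 0 < s) (K : Set (Fin n → ℝ)) (hK : K.Nonempty) (hKc : IsClosed K)
    (f : Fin s → MvPolynomial (Fin n) ℝ) (hdeg : ∀ i, 1 ≤ (f i).totalDegree) :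
    SOLw (asympCone K) (fun i => recFn (f i)) = ∅ ↔ (0 : Fin n → ℝ) ∉ SOLw (asympCone K) (fun i => recFn (f i)) := by
  constructor
  · intro h
    rw [h]
    exact Set.notMem_empty _
  · intro h0
    have h0' : ∃ y ∈ asympCone K, ∀ i, recFn (f i) y < recFn (f i) 0 := by
      by_contra hcon
      exact h0 ⟨zero_mem_asympCone_aux hK, fun y hy hlt => hcon ⟨y, hy, hlt⟩⟩
    obtain ⟨y, hy, hlt⟩ := h0'
    have hz : ∀ i, recFn (f i) 0 = 0 := fun i => by
      have := recFn_smul_aux (f i) 0 0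
      rw [zero_smul, zero_pow (by have := hdeg i; omega), zero_mul] at this
      exact this
    rw [Set.eq_empty_iff_forall_notMem]
    rintro x ⟨_, hx⟩
    have hev : ∀ᶠ c : ℝ in atTop, ∀ i, recFn (f i) (c • y) < recFn (f i) x := by
      rw [eventually_all]
      intro i
      have hneg : recFn (f i) y < 0 := by simpa [hz i] using hlt i
      have ht : Tendsto (fun c : ℝ => c ^ (f i).totalDegree * recFn (f i) y) atTop atBot :=
        (tendsto_pow_atTop (by have := hdeg i; omega)).atTop_mul_const_of_neg hneg
      filter_upwards [ht.eventually_lt_atBot (recFn (f i) x)] with c hc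
      rwa [recFn_smul_aux]
    obtain ⟨c, hc, hcp⟩ := (hev.and (eventually_gt_atTop 0)).exists
    exact hx _ (asympCone_smul_aux hcp hy) hc
end

section
/- If SOL^w(K_∞, f^∞) = ∅, then for every index i ∈ {1, …, s} the component polynomial f_i is unbounded from below on K (i.e., there is no real number l with f_i(x) ≥ l for all x ∈ K). -/
open Filter Topology MvPolynomial

theorem eval_hom_smul {n : ℕ} {p : MvPolynomial (Fin n) ℝ} {d : ℕ} (hp : p.IsHomogeneous d)
    (c : ℝ) (x : Fin n → ℝ) : eval (c • x) p = c ^ d * eval x p := by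
  rw [eval_eq, eval_eq, Finset.mul_sum]
  refine Finset.sum_congr rfl fun m hm => ?_
  have h : ∑ i ∈ m.support, m i = d := by
    have := hp (mem_support_iff.mp hm)
    rw [← this, Finsupp.weight_apply, Finsupp.sum]
    simp
  simp only [Pi.smul_apply, smul_eq_mul, mul_pow, Finset.prod_mul_distrib]
  rw [Finset.prod_pow_eq_pow_sum, h]
  ring

theorem tendsto_div_rec {n : ℕ} (p : MvPolynomial (Fin n) ℝ) (t : ℕ → ℝ) (x : ℕ → (Fin n → ℝ))
    (y : Fin n → ℝ) (ht : Tendsto t atTop atTop)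
    (hx : Tendsto (fun k => (t k)⁻¹ • x k) atTop (nhds y)) :
    Tendsto (fun k => evalFn p (x k) / t k ^ p.totalDegree) atTop (nhds (recFn p y)) := by
  have key : ∀ᶠ k in atTop, ∑ j ∈ Finset.range (p.totalDegree + 1),
      ((t k)⁻¹ ^ (p.totalDegree - j)) * eval ((t k)⁻¹ • x k) (homogeneousComponent j p)
      = evalFn p (x k) / t k ^ p.totalDegree := by
    filter_upwards [ht.eventually_gt_atTop 0] with k hk
    have h0 : t k ≠ 0 := hk.ne'
    have h1 : evalFn p (x k) = ∑ j ∈ Finset.range (p.totalDegree + 1),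
        eval (x k) (homogeneousComponent j p) := by
      rw [← map_sum, sum_homogeneousComponent]; rfl
    rw [h1, Finset.sum_div]
    refine Finset.sum_congr rfl fun j hj => ?_
    have hj' : j ≤ p.totalDegree := Nat.lt_succ_iff.mp (Finset.mem_range.mp hj)
    rw [eval_hom_smul (homogeneousComponent_isHomogeneous j p), ← mul_assoc, ← pow_add,
      Nat.sub_add_cancel hj', inv_pow, div_eq_mul_inv, mul_comm]
  refine Tendsto.congr' key ?_
  have hlim : recFn p y = ∑ j ∈ Finset.range (p.totalDegree + 1),
      (if j = p.totalDegree then 1 else 0) * eval y (homogeneousComponent j p) := by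
    simp [recFn]
  rw [hlim]
  refine tendsto_finsetSum _ fun j hj => ?_
  have hj' : j ≤ p.totalDegree := Nat.lt_succ_iff.mp (Finset.mem_range.mp hj)
  refine Tendsto.mul ?_ (((MvPolynomial.continuous_eval _).tendsto y).comp hx)
  split_ifs with h
  · simp [h]
  · have := (tendsto_inv_atTop_zero.comp ht).pow (p.totalDegree - j)
    rwa [zero_pow (by omega)] at this

theorem stmt2 {n s : ℕ} (hs : 0 < s) (K : Set (Fin n → ℝ)) (hK : K.Nonempty) (hKc : IsClosed K)
    (f : Fin s → MvPolynomial (Fin n) ℝ) (hdeg : ∀ i, 1 ≤ (f i).totalDegree)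
    (hemp : SOLw (asympCone K) (fun i => recFn (f i)) = ∅) :
    ∀ i, ¬ ∃ l : ℝ, ∀ x ∈ K, l ≤ evalFn (f i) x := by
  rintro i ⟨l, hl⟩
  obtain ⟨a, ha⟩ := hK
  have h0 : (0 : Fin n → ℝ) ∈ asympCone K := by
    refine ⟨fun k => (k : ℝ), fun _ => a, fun _ => ha, tendsto_natCast_atTop_atTop, ?_⟩
    have := (tendsto_inv_atTop_zero.comp
      (tendsto_natCast_atTop_atTop (R := ℝ))).smul_const a
    rwa [zero_smul] at this
  have hn : (0 : Fin n → ℝ) ∉ SOLw (asympCone K) (fun i => recFn (f i)) := by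
    rw [hemp]; exact Set.notMem_empty _
  have hex : ∃ y ∈ asympCone K, ∀ i, recFn (f i) y < recFn (f i) 0 := by
    by_contra hcon
    exact hn ⟨h0, fun y hy h => hcon ⟨y, hy, h⟩⟩
  obtain ⟨y, ⟨t, x, hxK, ht, hx⟩, hy⟩ := hex
  have hz : recFn (f i) 0 = 0 := by
    have := eval_hom_smul (homogeneousComponent_isHomogeneous (f i).totalDegree (f i)) 0 0
    rw [zero_pow (by have := hdeg i; omega), zero_mul, zero_smul] at this
    exact this
  have hlt := hy i
  rw [hz] at hlt
  have hT := tendsto_div_rec (f i) t x y ht hx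
  have hL : Tendsto (fun k => l / t k ^ (f i).totalDegree) atTop (nhds 0) :=
    Tendsto.const_div_atTop ((tendsto_pow_atTop (by have := hdeg i; omega)).comp ht) l
  refine absurd hlt (not_lt.mpr (le_of_tendsto_of_tendsto hL hT ?_))
  filter_upwards [ht.eventually_gt_atTop 0] with k hk
  have := hl (x k) (hxK k)
  gcongr
end

section
/- If f is bounded from below on K, then 0 is a Pareto efficient solution of f^∞ on K_∞, i.e., 0 ∈ SOL^s(K_∞, f^∞). -/
open Filter Topology MvPolynomial

theorem eval_smul_of_homog {n d : ℕ} {p : MvPolynomial (Fin n) ℝ} (hp : p.IsHomogeneous d)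
    (t : ℝ) (u : Fin n → ℝ) : eval (t • u) p = t ^ d * eval u p := by
  rw [eval_eq, eval_eq, Finset.mul_sum]
  refine Finset.sum_congr rfl fun m hm => ?_
  have h1 : ∑ i ∈ m.support, m i = d := by
    have := hp (mem_support_iff.mp hm)
    rw [← this, Finsupp.weight_apply, Finsupp.sum]
    simp
  simp only [Pi.smul_apply, smul_eq_mul, mul_pow, Finset.prod_mul_distrib,
    Finset.prod_pow_eq_pow_sum, h1]
  ring

theorem rec_nonneg {n : ℕ} (K : Set (Fin n → ℝ)) (p : MvPolynomial (Fin n) ℝ)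
    (hd : 1 ≤ p.totalDegree) (r : ℝ) (hr : ∀ x ∈ K, r ≤ evalFn p x)
    (v : Fin n → ℝ) (hv : v ∈ asympCone K) : 0 ≤ recFn p v := by
  obtain ⟨t, x, hx, ht, hu⟩ := hv
  set d := p.totalDegree with hdd
  have hinv : Tendsto (fun k => (t k)⁻¹) atTop (𝓝 0) := ht.inv_tendsto_atTop
  have hterm : ∀ k, Tendsto (fun m => eval ((t m)⁻¹ • x m) (homogeneousComponent k p)) atTop
      (𝓝 (eval v (homogeneousComponent k p))) := fun k =>
    ((MvPolynomial.continuous_eval (homogeneousComponent k p)).tendsto v).comp hu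
  have hlow : Tendsto (fun m => ∑ k ∈ Finset.range d,
      ((t m)⁻¹) ^ (d - k) * eval ((t m)⁻¹ • x m) (homogeneousComponent k p)) atTop (𝓝 0) := by
    have : Tendsto (fun m => ∑ k ∈ Finset.range d,
      ((t m)⁻¹) ^ (d - k) * eval ((t m)⁻¹ • x m) (homogeneousComponent k p)) atTop
      (𝓝 (∑ k ∈ Finset.range d, (0:ℝ) ^ (d - k) * eval v (homogeneousComponent k p))) :=
      tendsto_finsetSum _ fun k _ => (hinv.pow (d - k)).mul (hterm k)
    convert this using 2
    symm
    apply Finset.sum_eq_zero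
    intro k hk
    have : d - k ≠ 0 := by have := Finset.mem_range.mp hk; omega
    simp [this]
  have hall := hlow.add (hterm d)
  rw [zero_add] at hall
  have hleft : Tendsto (fun m => ((t m)⁻¹) ^ d * r) atTop (𝓝 0) := by
    have := (hinv.pow d).mul_const r
    rwa [zero_pow (by omega), zero_mul] at this
  refine le_of_tendsto_of_tendsto hleft hall ?_
  filter_upwards [ht.eventually_gt_atTop 0] with m hm
  have hxm : x m = t m • ((t m)⁻¹ • x m) := by rw [smul_smul, mul_inv_cancel₀ hm.ne', one_smul]
  have key : ((t m)⁻¹) ^ d * evalFn p (x m) = ∑ k ∈ Finset.range d,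
      ((t m)⁻¹) ^ (d - k) * eval ((t m)⁻¹ • x m) (homogeneousComponent k p)
      + eval ((t m)⁻¹ • x m) (homogeneousComponent d p) := by
    have h0 : evalFn p (x m) = ∑ k ∈ Finset.range (d + 1),
        eval (x m) (homogeneousComponent k p) := by
      rw [← map_sum, hdd, sum_homogeneousComponent]; rfl
    rw [h0, Finset.mul_sum, Finset.sum_range_succ]
    have hk : ∀ k ≤ d, ((t m)⁻¹) ^ d * eval (x m) (homogeneousComponent k p) =
        ((t m)⁻¹) ^ (d - k) * eval ((t m)⁻¹ • x m) (homogeneousComponent k p) := by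
      intro k hk
      rw [eval_smul_of_homog (homogeneousComponent_isHomogeneous k p), ← mul_assoc, ← pow_add,
        Nat.sub_add_cancel hk]
    congr 1
    · exact Finset.sum_congr rfl fun k h => hk k (Finset.mem_range.mp h).le
    · simpa using hk d le_rfl
  rw [← key]
  exact mul_le_mul_of_nonneg_left (hr _ (hx m)) (by positivity)

theorem stmt3 {n s : ℕ} (hs : 0 < s) (K : Set (Fin n → ℝ)) (hK : K.Nonempty) (hKc : IsClosed K)
    (f : Fin s → MvPolynomial (Fin n) ℝ) (hdeg : ∀ i, 1 ≤ (f i).totalDegree)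
    (hbdd : ∃ r : Fin s → ℝ, ∀ x ∈ K, ∀ i, r i ≤ evalFn (f i) x) :
    (0 : Fin n → ℝ) ∈ SOLs (asympCone K) (fun i => recFn (f i)) := by
  obtain ⟨r, hr⟩ := hbdd
  refine ⟨?_, ?_⟩
  · obtain ⟨x0, hx0⟩ := hK
    refine ⟨fun k => (k : ℝ), fun _ => x0, fun _ => hx0, tendsto_natCast_atTop_atTop, ?_⟩
    have := (tendsto_inv_atTop_nhds_zero_nat (𝕜 := ℝ)).smul_const x0
    rwa [zero_smul] at this
  · rintro y hy ⟨-, i, hi⟩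
    have h1 := rec_nonneg K (f i) (hdeg i) (r i) (fun x hx => hr x hx i) y hy
    have h2 : recFn (f i) 0 = 0 := by
      have := eval_smul_of_homog (homogeneousComponent_isHomogeneous (f i).totalDegree (f i)) 0 0
      rw [zero_smul, zero_pow (by have := hdeg i; omega), zero_mul] at this
      exact this
    simp only [h2] at hi
    linarith
end

section
/- The set SOL^w(K_∞, f^∞) is bounded and f is bounded from below on K if and only if SOL(K_∞, f_i^∞) = {0} for every i ∈ {1, …, s}. -/
open Filter Topology MvPolynomial

lemma eval_smul_hom {n d : ℕ} {p : MvPolynomial (Fin n) ℝ} (hp : p.IsHomogeneous d) (t : ℝ)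
    (x : Fin n → ℝ) : eval (t • x) p = t ^ d * eval x p := by
  rw [eval_eq', eval_eq', Finset.mul_sum]
  refine Finset.sum_congr rfl fun m hm => ?_
  have h : ∑ i, m i = d := by
    have := hp (mem_support_iff.1 hm)
    rw [← this, Finsupp.weight_apply, Finsupp.sum_fintype _ _ (by simp)]
    simp
  simp only [Pi.smul_apply, smul_eq_mul, mul_pow, Finset.prod_mul_distrib]
  rw [Finset.prod_pow_eq_pow_sum, h]
  ring

lemma recFn_smul {n : ℕ} (p : MvPolynomial (Fin n) ℝ) (t : ℝ) (x : Fin n → ℝ) :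
    recFn p (t • x) = t ^ p.totalDegree * recFn p x :=
  eval_smul_hom (homogeneousComponent_isHomogeneous _ _) t x

lemma recFn_zero {n : ℕ} (p : MvPolynomial (Fin n) ℝ) (h : 1 ≤ p.totalDegree) :
    recFn p 0 = 0 := by
  have := recFn_smul p 0 0
  rwa [zero_pow (by omega), zero_mul, smul_zero] at this

lemma key {n : ℕ} (p : MvPolynomial (Fin n) ℝ) (t : ℕ → ℝ) (x : ℕ → (Fin n → ℝ))
    (v : Fin n → ℝ) (ht : Tendsto t atTop atTop)
    (hx : Tendsto (fun k => (t k)⁻¹ • x k) atTop (nhds v)) :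
    Tendsto (fun k => ((t k)⁻¹) ^ p.totalDegree * evalFn p (x k)) atTop (nhds (recFn p v)) := by
  set d := p.totalDegree with hd
  have h1 : ∀ j ∈ Finset.range (d + 1), Tendsto (fun k => ((t k)⁻¹) ^ (d - j) *
      eval ((t k)⁻¹ • x k) (homogeneousComponent j p)) atTop
      (nhds ((0:ℝ) ^ (d - j) * eval v (homogeneousComponent j p))) := fun j _ =>
    ((tendsto_inv_atTop_zero.comp ht).pow _).mul
      (((MvPolynomial.continuous_eval _).tendsto v).comp hx)
  have h2 := tendsto_finsetSum _ h1
  have h3 : ∑ j ∈ Finset.range (d + 1), (0:ℝ) ^ (d - j) * eval v (homogeneousComponent j p)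
      = recFn p v := by
    rw [Finset.sum_range_succ, Finset.sum_eq_zero]
    · simp [recFn, hd]
    · intro j hj
      rw [Finset.mem_range] at hj
      rw [zero_pow (by omega), zero_mul]
  rw [h3] at h2
  refine h2.congr' ?_
  filter_upwards [ht.eventually_gt_atTop 0] with k hk
  have h4 : evalFn p (x k) = ∑ j ∈ Finset.range (d + 1), eval (x k) (homogeneousComponent j p) := by
    rw [← map_sum, sum_homogeneousComponent]; rfl
  rw [h4, Finset.mul_sum]
  refine Finset.sum_congr rfl fun j hj => ?_
  rw [Finset.mem_range] at hj
  rw [eval_smul_hom (homogeneousComponent_isHomogeneous _ _), ← mul_assoc, ← pow_add,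
    Nat.sub_add_cancel (by omega)]

lemma zero_mem_asympCone {n : ℕ} {K : Set (Fin n → ℝ)} (hK : K.Nonempty) : 0 ∈ asympCone K := by
  obtain ⟨x, hx⟩ := hK
  refine ⟨fun k => (k:ℝ), fun _ => x, fun _ => hx, tendsto_natCast_atTop_atTop, ?_⟩
  have := (tendsto_inv_atTop_zero.comp (tendsto_natCast_atTop_atTop (R := ℝ))).smul_const x
  simpa using this

lemma smul_mem_asympCone {n : ℕ} {K : Set (Fin n → ℝ)} {v : Fin n → ℝ} (hv : v ∈ asympCone K)
    {c : ℝ} (hc : 0 < c) : c • v ∈ asympCone K := by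
  obtain ⟨t, x, hx, ht, h⟩ := hv
  refine ⟨fun k => c⁻¹ * t k, x, hx, ht.const_mul_atTop (inv_pos.2 hc), ?_⟩
  refine (h.const_smul c).congr fun k => ?_
  rw [mul_inv, inv_inv, smul_smul]

lemma bddBelow_of {n : ℕ} {K : Set (Fin n → ℝ)} (hKc : IsClosed K) (p : MvPolynomial (Fin n) ℝ)
    (hpos : ∀ v ∈ asympCone K, v ≠ 0 → 0 < recFn p v) : ∃ r : ℝ, ∀ x ∈ K, r ≤ evalFn p x := by
  have h1 : ∃ R : ℕ, ∀ x ∈ K, (R:ℝ) + 1 ≤ ‖x‖ → 0 ≤ evalFn p x := by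
    by_contra! hcon
    choose x hx hn hneg using hcon
    have ht : Tendsto (fun k => ‖x k‖) atTop atTop :=
      tendsto_atTop_mono (fun k => (le_add_of_nonneg_right zero_le_one).trans (hn k))
        (tendsto_natCast_atTop_atTop (R := ℝ))
    have hne : ∀ k, 0 < ‖x k‖ := fun k => lt_of_lt_of_le (by positivity) (hn k)
    have hs : ∀ k, ‖x k‖⁻¹ • x k ∈ Metric.sphere (0 : Fin n → ℝ) 1 := fun k => by
      simp [norm_smul, (hne k).ne']
    obtain ⟨v, hv, φ, hφ, hlim⟩ := (isCompact_sphere (0 : Fin n → ℝ) 1).tendsto_subseq hs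
    have ht' := ht.comp hφ.tendsto_atTop
    have hvK : v ∈ asympCone K := ⟨_, fun k => x (φ k), fun k => hx _, ht', hlim⟩
    have hv0 : v ≠ 0 := by
      rintro rfl
      simp at hv
    have := key p _ _ v ht' hlim
    have hle := le_of_tendsto' this (b := 0) fun k =>
      mul_nonpos_of_nonneg_of_nonpos (pow_nonneg (inv_nonneg.2 (norm_nonneg _)) _) (hneg _).le
    exact absurd (hpos v hvK hv0) (not_lt.2 hle)
  obtain ⟨R, hR⟩ := h1
  have hcomp : IsCompact (K ∩ Metric.closedBall 0 ((R:ℝ) + 1)) :=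
    (isCompact_closedBall _ _).inter_left hKc
  obtain ⟨b, hb⟩ := hcomp.bddBelow_image (f := evalFn p) (MvPolynomial.continuous_eval p).continuousOn
  refine ⟨min b 0, fun x hx => ?_⟩
  rcases le_total ((R:ℝ) + 1) ‖x‖ with h | h
  · exact (min_le_right _ _).trans (hR x hx h)
  · exact (min_le_left _ _).trans (hb ⟨x, ⟨hx, by simpa using h⟩, rfl⟩)

theorem stmt6 {n s : ℕ} (hs : 0 < s) (K : Set (Fin n → ℝ)) (hK : K.Nonempty) (hKc : IsClosed K)
    (f : Fin s → MvPolynomial (Fin n) ℝ) (hdeg : ∀ i, 1 ≤ (f i).totalDegree) :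
    (Bornology.IsBounded (SOLw (asympCone K) (fun i => recFn (f i))) ∧
        ∃ r : Fin s → ℝ, ∀ x ∈ K, ∀ i, r i ≤ evalFn (f i) x) ↔
      ∀ i, SOLmin (asympCone K) (recFn (f i)) = {0} := by
  have h0 := zero_mem_asympCone hK
  constructor
  · rintro ⟨hb, r, hr⟩ i
    have hnn : ∀ v ∈ asympCone K, 0 ≤ recFn (f i) v := by
      rintro v ⟨t, x, hx, ht, h⟩
      have h1 := key (f i) t x v ht h
      have h2 : Tendsto (fun k => ((t k)⁻¹) ^ (f i).totalDegree * r i) atTop (nhds 0) := by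
        have := ((tendsto_inv_atTop_zero.comp ht).pow (f i).totalDegree).mul_const (r i)
        have hd := hdeg i
        rwa [zero_pow (by omega), zero_mul] at this
      refine le_of_tendsto_of_tendsto h2 h1 ?_
      filter_upwards [ht.eventually_gt_atTop 0] with k hk
      exact mul_le_mul_of_nonneg_left (hr _ (hx k) i) (by positivity)
    ext v
    simp only [Set.mem_singleton_iff]
    constructor
    · rintro ⟨hv, hmin⟩
      by_contra hv0
      have hz : recFn (f i) v = 0 :=
        le_antisymm ((hmin 0 h0).trans (recFn_zero _ (hdeg i)).le) (hnn v hv)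
      obtain ⟨C, hC⟩ := hb.exists_norm_le
      have hvn : 0 < ‖v‖ := norm_pos_iff.2 hv0
      have hc : 0 < (|C| + 1) / ‖v‖ := by positivity
      have := hC (((|C| + 1) / ‖v‖) • v) ⟨smul_mem_asympCone hv hc, fun y hy hlt => by
        have := hlt i
        simp only [recFn_smul, hz, mul_zero] at this
        exact absurd (hnn y hy) (not_le.2 this)⟩
      rw [norm_smul, Real.norm_of_nonneg hc.le, div_mul_cancel₀ _ hvn.ne'] at this
      linarith [le_abs_self C]
    · rintro rfl
      exact ⟨h0, fun y hy => (recFn_zero _ (hdeg i)).le.trans (hnn y hy)⟩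
  · intro h
    have hpos : ∀ i, ∀ v ∈ asympCone K, v ≠ 0 → 0 < recFn (f i) v := by
      intro i v hv hv0
      have hm : (0 : Fin n → ℝ) ∈ SOLmin (asympCone K) (recFn (f i)) := by rw [h i]; rfl
      have hz := recFn_zero _ (hdeg i)
      by_contra hle
      have : v ∈ SOLmin (asympCone K) (recFn (f i)) :=
        ⟨hv, fun y hy => (not_lt.1 hle).trans (hz.ge.trans (hm.2 y hy))⟩
      rw [h i] at this
      exact hv0 this
    constructor
    · refine (Bornology.isBounded_singleton (x := (0 : Fin n → ℝ))).subset ?_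
      rintro v ⟨hv, hn⟩
      by_contra hv0
      refine hn 0 h0 fun i => ?_
      simp only [recFn_zero _ (hdeg i)]
      exact hpos i v hv hv0
    · choose r hr using fun i => bddBelow_of hKc (f i) (hpos i)
      exact ⟨r, fun x hx i => hr i x hx⟩
end

section
/- Assume K is convex. If the weak vector complementarity problem WVCP(K_∞, ∇f^∞) is of type R_0 (i.e., x = 0 is its only solution), then PVOP(K, f) is strongly regular, i.e., SOL^w(K_∞, f^∞) is bounded. -/
open Filter Topology MvPolynomial

theorem aux_deriv {n : ℕ} (p : MvPolynomial (Fin n) ℝ) (x y : Fin n → ℝ) :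
    HasDerivAt (fun t : ℝ => eval (x + t • y) p) (∑ j, eval x (pderiv j p) * y j) 0 := by
  induction p using MvPolynomial.induction_on with
  | C a => simpa using hasDerivAt_const (0 : ℝ) a
  | add p q hp hq =>
    have := hp.add hq
    simp only [map_add, add_mul, Finset.sum_add_distrib]
    exact this
  | mul_X p i hp =>
    have h1 : HasDerivAt (fun t : ℝ => x i + t * y i) (y i) 0 := by
      simpa using ((hasDerivAt_id (0 : ℝ)).mul_const (y i)).const_add (x i)
    have h2 := hp.mul h1
    have h3 : (fun t : ℝ => eval (x + t • y) (p * X i)) =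
        (fun t : ℝ => eval (x + t • y) p) * fun t : ℝ => x i + t * y i := by
      funext t
      simp
    rw [h3]
    refine h2.congr_deriv ?_
    · simp [Derivation.leibniz, pderiv_X, add_mul, Finset.sum_add_distrib, Pi.single_apply,
        Finset.sum_mul, apply_ite]
      rw [add_comm]
      congr 1
      exact Finset.sum_congr rfl fun j _ => by ring

theorem aux_desc {n : ℕ} (p : MvPolynomial (Fin n) ℝ) (x y : Fin n → ℝ)
    (h : gradRecInner p x y < 0) :
    ∀ᶠ t in 𝓝[>] (0 : ℝ), recFn p (x + t • y) < recFn p x := by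
  have hd := aux_deriv (homogeneousComponent p.totalDegree p) x y
  have h1 := (hasDerivAt_iff_tendsto_slope.1 hd).eventually (gt_mem_nhds h)
  have h2 : 𝓝[>] (0 : ℝ) ≤ 𝓝[≠] 0 := nhdsWithin_mono _ fun t ht => ne_of_gt ht
  filter_upwards [h2 h1, self_mem_nhdsWithin] with t ht ht0
  have ht0' : (0 : ℝ) < t := ht0
  simp only [Set.mem_setOf_eq, slope_def_field, sub_zero, zero_smul, add_zero] at ht
  have := (div_neg_iff.1 ht).resolve_left (fun h => by linarith [h.2])
  unfold recFn
  linarith [this.1]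

theorem aux_rec {n : ℕ} {K : Set (Fin n → ℝ)} (hKc : IsClosed K) (hconv : Convex ℝ K)
    {v z : Fin n → ℝ} (hv : v ∈ asympCone K) (hz : z ∈ K) {l : ℝ} (hl : 0 ≤ l) :
    z + l • v ∈ K := by
  obtain ⟨t, x, hx, ht, hlim⟩ := hv
  have hinv : Tendsto (fun k => (t k)⁻¹) atTop (𝓝 0) := tendsto_inv_atTop_zero.comp ht
  have hT : Tendsto (fun k => z + l • ((t k)⁻¹ • x k - (t k)⁻¹ • z)) atTop (𝓝 (z + l • v)) := by
    have := ((hlim.sub (hinv.smul_const z)).const_smul l).const_add z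
    simpa using this
  refine hKc.mem_of_tendsto hT ?_
  filter_upwards [ht.eventually_ge_atTop l, ht.eventually_gt_atTop 0] with k h1 h2
  have := hconv.add_smul_sub_mem hz (hx k) (t := l * (t k)⁻¹)
    ⟨by positivity, by rw [← div_eq_mul_inv]; exact (div_le_one h2).2 h1⟩
  convert this using 2
  rw [← smul_sub, smul_smul]

theorem aux_mem {n : ℕ} {K : Set (Fin n → ℝ)} {u z : Fin n → ℝ}
    (h : ∀ l : ℝ, 0 ≤ l → z + l • u ∈ K) : u ∈ asympCone K := by
  refine ⟨fun k => (k : ℝ) + 1, fun k => z + ((k : ℝ) + 1) • u, fun k => h _ (by positivity), ?_, ?_⟩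
  · exact tendsto_atTop_add_const_right _ _ tendsto_natCast_atTop_atTop
  · have ht : Tendsto (fun k : ℕ => (k : ℝ) + 1) atTop atTop :=
      tendsto_atTop_add_const_right _ _ tendsto_natCast_atTop_atTop
    have hinv : Tendsto (fun k : ℕ => ((k : ℝ) + 1)⁻¹) atTop (𝓝 0) :=
      tendsto_inv_atTop_zero.comp ht
    have := (hinv.smul_const z).add_const u
    simp only [zero_smul, zero_add] at this
    refine this.congr fun k => ?_
    have : (k : ℝ) + 1 ≠ 0 := by positivity
    rw [smul_add, smul_smul, inv_mul_cancel₀ this, one_smul]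

theorem stmt8 {n s : ℕ} (hs : 0 < s) (K : Set (Fin n → ℝ)) (hK : K.Nonempty) (hKc : IsClosed K)
    (f : Fin s → MvPolynomial (Fin n) ℝ) (hdeg : ∀ i, 1 ≤ (f i).totalDegree) (hconv : Convex ℝ K)
    (hR0 : {x | isWVCPsol (asympCone K) f x} = {0}) :
    Bornology.IsBounded (SOLw (asympCone K) (fun i => recFn (f i))) := by
  have key : ∀ x ∈ SOLw (asympCone K) (fun i => recFn (f i)), x = 0 := by
    rintro x ⟨hxC, hx⟩
    have hne : ∀ y : Fin n → ℝ, (∀ᶠ t in 𝓝[>] (0 : ℝ), x + t • y ∈ asympCone K) →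
        ¬ (∀ i, gradRecInner (f i) x y < 0) := by
      intro y hy h
      have h1 := eventually_all.2 fun i => aux_desc (f i) x y (h i)
      obtain ⟨t, ht1, ht2⟩ := (hy.and h1).exists
      exact hx _ ht1 ht2
    obtain ⟨z, hz⟩ := hK
    have hsol : x ∈ {x | isWVCPsol (asympCone K) f x} := by
      refine ⟨hxC, fun y hy => hne y ?_, fun h => hne (-x) ?_ ?_⟩
      · filter_upwards [self_mem_nhdsWithin] with t ht
        have ht' : (0 : ℝ) < t := ht
        refine aux_mem (z := z) fun l hl => ?_
        have := aux_rec hKc hconv hy (aux_rec hKc hconv hxC hz hl)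
          (l := l * t) (by positivity)
        rwa [mul_smul, add_assoc, ← smul_add] at this
      · filter_upwards [Ioo_mem_nhdsGT (zero_lt_one' ℝ)] with t ht
        refine aux_mem (z := z) fun l hl => ?_
        have := aux_rec hKc hconv hxC hz (l := l * (1 - t))
          (mul_nonneg hl (by linarith [ht.2]))
        convert this using 2
        rw [mul_smul, sub_smul, one_smul, smul_neg, sub_eq_add_neg]
      · intro i
        have := h i
        simp only [gradRecInner, Pi.neg_apply, mul_neg, Finset.sum_neg_distrib] at this ⊢
        linarith
    rw [hR0] at hsol
    exact hsol
  exact Bornology.isBounded_singleton.subset fun x hx => Set.mem_singleton_iff.2 (key x hx)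
end

section
/- If there exists an index i_0 ∈ {1, …, s} such that SOL(K_∞, f_{i_0}^∞) = {0}, then the Pareto efficient solution set SOL^s(K, f) is nonempty. -/
open Filter Topology MvPolynomial

lemma eval_smul_homog {n d : ℕ} {p : MvPolynomial (Fin n) ℝ} (hp : p.IsHomogeneous d)
    (r : ℝ) (x : Fin n → ℝ) : eval (r • x) p = r ^ d * eval x p := by
  rw [eval_eq, eval_eq, Finset.mul_sum]
  refine Finset.sum_congr rfl fun m hm => ?_
  have h1 : ∑ i ∈ m.support, m i = d := by
    have := hp (mem_support_iff.mp hm)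
    rw [Finsupp.weight_apply] at this
    simpa [Finsupp.sum] using this
  simp only [Pi.smul_apply, smul_eq_mul, mul_pow, Finset.prod_mul_distrib]
  rw [Finset.prod_pow_eq_pow_sum, h1]
  ring

lemma tendsto_rec {n : ℕ} (p : MvPolynomial (Fin n) ℝ) (t : ℕ → ℝ) (y : ℕ → Fin n → ℝ)
    (v : Fin n → ℝ) (ht : Tendsto t atTop atTop) (hy : Tendsto y atTop (nhds v)) :
    Tendsto (fun k => evalFn p (t k • y k) / t k ^ p.totalDegree) atTop (nhds (recFn p v)) := by
  have hc : ∀ j, Tendsto (fun k => eval (y k) (homogeneousComponent j p)) atTop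
      (nhds (eval v (homogeneousComponent j p))) := fun j =>
    ((MvPolynomial.continuous_eval (homogeneousComponent j p)).tendsto v).comp hy
  have hform : ∀ k, evalFn p (t k • y k) / t k ^ p.totalDegree =
      ∑ j ∈ Finset.range p.totalDegree,
        (t k ^ j / t k ^ p.totalDegree) * eval (y k) (homogeneousComponent j p)
      + (t k ^ p.totalDegree / t k ^ p.totalDegree)
        * eval (y k) (homogeneousComponent p.totalDegree p) := by
    intro k
    rw [← Finset.sum_range_succ (fun j => (t k ^ j / t k ^ p.totalDegree)
      * eval (y k) (homogeneousComponent j p))]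
    unfold evalFn
    conv_lhs => rw [← sum_homogeneousComponent p]
    rw [map_sum, sum_homogeneousComponent p, Finset.sum_div]
    refine Finset.sum_congr rfl fun j _ => ?_
    rw [eval_smul_homog (homogeneousComponent_isHomogeneous j p)]
    ring
  simp_rw [hform]
  have h0 : Tendsto (fun k => ∑ j ∈ Finset.range p.totalDegree,
        (t k ^ j / t k ^ p.totalDegree) * eval (y k) (homogeneousComponent j p))
        atTop (nhds (∑ j ∈ Finset.range p.totalDegree,
          0 * eval v (homogeneousComponent j p))) := by
    refine tendsto_finsetSum _ fun j hj => ?_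
    exact ((tendsto_pow_div_pow_atTop_zero (Finset.mem_range.mp hj)).comp ht).mul (hc j)
  have h1 : Tendsto (fun k => (t k ^ p.totalDegree / t k ^ p.totalDegree)) atTop (nhds 1) := by
    refine tendsto_const_nhds.congr' ?_
    filter_upwards [ht.eventually_gt_atTop 0] with k hk
    rw [div_self (pow_pos hk _).ne']
  simpa [recFn] using h0.add (h1.mul (hc p.totalDegree))

lemma sublevel_bounded {n : ℕ} (K : Set (Fin n → ℝ)) (p : MvPolynomial (Fin n) ℝ)
    (hdeg : 1 ≤ p.totalDegree) (h : SOLmin (asympCone K) (recFn p) = {0}) (c : ℝ) :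
    Bornology.IsBounded {x | x ∈ K ∧ evalFn p x ≤ c} := by
  by_contra hb
  have hx : ∀ k : ℕ, ∃ x, (x ∈ K ∧ evalFn p x ≤ c) ∧ (k : ℝ) < ‖x‖ := by
    intro k
    by_contra hcon
    push Not at hcon
    exact hb (isBounded_iff_forall_norm_le.mpr ⟨k, fun x hx => hcon x hx⟩)
  choose x hx hxn using hx
  have hpos : ∀ k, 0 < ‖x k‖ := fun k => lt_of_le_of_lt (Nat.cast_nonneg k) (hxn k)
  have ht : Tendsto (fun k => ‖x k‖) atTop atTop :=
    tendsto_atTop_mono (fun k => (hxn k).le) tendsto_natCast_atTop_atTop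
  have hs : ∀ k, ‖x k‖⁻¹ • x k ∈ Metric.sphere (0 : Fin n → ℝ) 1 := by
    intro k
    simp [norm_smul, (hpos k).ne']
  obtain ⟨v, hv, φ, hφ, hlim⟩ := (isCompact_sphere (0 : Fin n → ℝ) 1).tendsto_subseq hs
  have ht' := ht.comp hφ.tendsto_atTop
  have hvK : v ∈ asympCone K := ⟨_, fun k => x (φ k), fun k => (hx _).1, ht', hlim⟩
  have hrec := tendsto_rec p _ _ v ht' hlim
  have hle : recFn p v ≤ 0 := by
    have hz : Tendsto (fun k => c / (‖x (φ k)‖) ^ p.totalDegree) atTop (nhds 0) :=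
      ((tendsto_pow_atTop (by omega)).comp ht').const_div_atTop c
    refine le_of_tendsto_of_tendsto' hrec hz fun k => ?_
    have e : ‖x (φ k)‖ • (‖x (φ k)‖⁻¹ • x (φ k)) = x (φ k) := by
      rw [smul_smul, mul_inv_cancel₀ (hpos _).ne', one_smul]
    simp only [Function.comp_apply, e]
    exact div_le_div_of_nonneg_right (hx _).2 (pow_pos (hpos _) _).le
  have h0 : (0 : Fin n → ℝ) ∈ SOLmin (asympCone K) (recFn p) := by rw [h]; rfl
  have hr0 : recFn p 0 = 0 := by
    have := eval_smul_homog (homogeneousComponent_isHomogeneous p.totalDegree p) 0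
      (0 : Fin n → ℝ)
    rw [zero_smul, zero_pow (by omega), zero_mul] at this
    exact this
  have hvm : v ∈ SOLmin (asympCone K) (recFn p) :=
    ⟨hvK, fun y hy => hle.trans (hr0 ▸ h0.2 y hy)⟩
  rw [h] at hvm
  have : v = 0 := hvm
  subst this
  simp at hv

theorem stmt10 {n s : ℕ} (hs : 0 < s) (K : Set (Fin n → ℝ)) (hK : K.Nonempty) (hKc : IsClosed K)
    (f : Fin s → MvPolynomial (Fin n) ℝ) (hdeg : ∀ i, 1 ≤ (f i).totalDegree)
    (h : ∃ i₀, SOLmin (asympCone K) (recFn (f i₀)) = {0}) :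
    (SOLs K (fun i => evalFn (f i))).Nonempty := by
  obtain ⟨i₀, hi⟩ := h
  obtain ⟨x₀, hx₀⟩ := hK
  have hcont : ∀ i, Continuous (evalFn (f i)) := fun i => MvPolynomial.continuous_eval (f i)
  set M : Set (Fin n → ℝ) := K ∩ ⋂ i, {x | evalFn (f i) x ≤ evalFn (f i) x₀} with hM
  have hMc : IsClosed M :=
    hKc.inter (isClosed_iInter fun i => isClosed_le (hcont i) continuous_const)
  have hMb : Bornology.IsBounded M :=
    (sublevel_bounded K (f i₀) (hdeg i₀) hi (evalFn (f i₀) x₀)).subset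
      fun x hx => ⟨hx.1, Set.mem_iInter.mp hx.2 i₀⟩
  have hMk : IsCompact M := Metric.isCompact_of_isClosed_isBounded hMc hMb
  obtain ⟨x, hx, hmin⟩ := hMk.exists_isMinOn
    ⟨x₀, hx₀, Set.mem_iInter.mpr fun i => le_refl (evalFn (f i) x₀)⟩
    (f := fun x => ∑ i, evalFn (f i) x)
    (continuous_finset_sum _ fun i _ => hcont i).continuousOn
  refine ⟨x, hx.1, fun y hy ⟨hle, j, hj⟩ => ?_⟩
  have hyM : y ∈ M :=
    ⟨hy, Set.mem_iInter.mpr fun i => (hle i).trans (Set.mem_iInter.mp hx.2 i)⟩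
  have h1 := isMinOn_iff.mp hmin y hyM
  have h2 : ∑ i, evalFn (f i) y < ∑ i, evalFn (f i) x :=
    Finset.sum_lt_sum (fun i _ => hle i) ⟨j, Finset.mem_univ j, hj⟩
  exact absurd h2 (not_lt.mpr h1)
end

section
/- If PVOP(K, f) is weakly regular (i.e., SOL^s(K_∞, f^∞) is bounded) and f is bounded from below on K, then the Pareto efficient solution set SOL^s(K, f) is nonempty. -/
open Filter Topology MvPolynomial

lemma aux_hom {n : ℕ} (p : MvPolynomial (Fin n) ℝ) (j : ℕ) (c : ℝ) (x : Fin n → ℝ) :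
    eval (c • x) (homogeneousComponent j p) = c ^ j * eval x (homogeneousComponent j p) := by
  rw [eval_eq', eval_eq', Finset.mul_sum]
  refine Finset.sum_congr rfl fun d hd => ?_
  have h := homogeneousComponent_isHomogeneous j p (mem_support_iff.1 hd)
  have h' : ∑ i, d i = j := by
    rw [← h, Finsupp.weight_apply, Finsupp.sum_fintype] <;> simp
  simp only [Pi.smul_apply, smul_eq_mul, mul_pow, Finset.prod_mul_distrib,
    Finset.prod_pow_eq_pow_sum, h']
  ring

lemma aux_lim {n : ℕ} (p : MvPolynomial (Fin n) ℝ) (t : ℕ → ℝ) (x : ℕ → (Fin n → ℝ))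
    (v : Fin n → ℝ) (ht : Tendsto t atTop atTop)
    (hx : Tendsto (fun k => (t k)⁻¹ • x k) atTop (nhds v)) :
    Tendsto (fun k => evalFn p (x k) / (t k) ^ p.totalDegree) atTop (nhds (recFn p v)) := by
  have hcont : ∀ j, Tendsto (fun k => eval ((t k)⁻¹ • x k) (homogeneousComponent j p)) atTop
      (nhds (eval v (homogeneousComponent j p))) := fun j =>
    ((MvPolynomial.continuous_eval (homogeneousComponent j p)).tendsto v).comp hx
  have h1 : Tendsto (fun k => ∑ j ∈ Finset.range (p.totalDegree + 1),
      ((t k)⁻¹) ^ (p.totalDegree - j) * eval ((t k)⁻¹ • x k) (homogeneousComponent j p)) atTop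
      (nhds (∑ j ∈ Finset.range (p.totalDegree + 1),
        (0:ℝ) ^ (p.totalDegree - j) * eval v (homogeneousComponent j p))) :=
    tendsto_finsetSum _ fun j _ => ((tendsto_inv_atTop_zero.comp ht).pow _).mul (hcont j)
  have h2 : ∑ j ∈ Finset.range (p.totalDegree + 1),
        (0:ℝ) ^ (p.totalDegree - j) * eval v (homogeneousComponent j p) = recFn p v := by
    rw [Finset.sum_range_succ, Finset.sum_eq_zero]
    · simp [recFn]
    · intro j hj
      have := Finset.mem_range.1 hj
      rw [zero_pow (by omega), zero_mul]
  rw [h2] at h1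
  refine h1.congr' ?_
  filter_upwards [ht.eventually_gt_atTop 0] with k hk
  have h3 : evalFn p (x k) = ∑ j ∈ Finset.range (p.totalDegree + 1),
      eval (x k) (homogeneousComponent j p) := by
    conv_lhs => rw [evalFn, ← MvPolynomial.sum_homogeneousComponent p]
    simp
  rw [h3, Finset.sum_div]
  refine Finset.sum_congr rfl fun j hj => ?_
  have hj' := Finset.mem_range.1 hj
  have h4 : eval ((t k)⁻¹ • x k) (homogeneousComponent j p)
      = (t k)⁻¹ ^ j * eval (x k) (homogeneousComponent j p) := aux_hom _ _ _ _
  rw [h4, ← mul_assoc, ← pow_add, Nat.sub_add_cancel (by omega), inv_pow]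
  field_simp

lemma aux_nonneg {n : ℕ} (K : Set (Fin n → ℝ)) (p : MvPolynomial (Fin n) ℝ)
    (hd : 1 ≤ p.totalDegree) (r : ℝ) (h : ∀ x ∈ K, r ≤ evalFn p x)
    (v : Fin n → ℝ) (hv : v ∈ asympCone K) : 0 ≤ recFn p v := by
  obtain ⟨t, x, hxK, ht, hx⟩ := hv
  have h1 := aux_lim p t x v ht hx
  have h2 : Tendsto (fun k => r / (t k) ^ p.totalDegree) atTop (nhds 0) :=
    tendsto_const_nhds.div_atTop ((tendsto_pow_atTop (by omega)).comp ht)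
  refine le_of_tendsto_of_tendsto h2 h1 ?_
  filter_upwards [ht.eventually_gt_atTop 0] with k hk
  have := h _ (hxK k)
  show r / _ ≤ _
  gcongr

lemma aux_cone {n : ℕ} (K : Set (Fin n → ℝ)) (v : Fin n → ℝ) (hv : v ∈ asympCone K)
    (c : ℝ) (hc : 0 < c) : c • v ∈ asympCone K := by
  obtain ⟨t, x, hxK, ht, hx⟩ := hv
  refine ⟨fun k => t k / c, x, hxK, ht.atTop_div_const hc, ?_⟩
  refine (hx.const_smul c).congr fun k => ?_
  rw [smul_smul, inv_div, div_eq_mul_inv]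

theorem stmt11 {n s : ℕ} (hs : 0 < s) (K : Set (Fin n → ℝ)) (hK : K.Nonempty) (hKc : IsClosed K)
    (f : Fin s → MvPolynomial (Fin n) ℝ) (hdeg : ∀ i, 1 ≤ (f i).totalDegree)
    (hreg : Bornology.IsBounded (SOLs (asympCone K) (fun i => recFn (f i))))
    (hbdd : ∃ r : Fin s → ℝ, ∀ x ∈ K, ∀ i, r i ≤ evalFn (f i) x) :
    (SOLs K (fun i => evalFn (f i))).Nonempty := by
  obtain ⟨r, hr⟩ := hbdd
  have hnn : ∀ i, ∀ v ∈ asympCone K, 0 ≤ recFn (f i) v := fun i v hv =>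
    aux_nonneg K (f i) (hdeg i) (r i) (fun x hx => hr x hx i) v hv
  have hzero : ∀ v ∈ asympCone K, (∀ i, recFn (f i) v = 0) → v = 0 := by
    intro v hv h0
    by_contra hne
    obtain ⟨C, hC⟩ := hreg.exists_norm_le
    have hvpos : 0 < ‖v‖ := norm_pos_iff.2 hne
    have hcpos : 0 < (|C| + 1) / ‖v‖ := by positivity
    have hmem : ((|C| + 1) / ‖v‖) • v ∈ SOLs (asympCone K) (fun i => recFn (f i)) := by
      refine ⟨aux_cone K v hv _ hcpos, ?_⟩
      rintro y hy ⟨-, i, hi⟩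
      have h1 : recFn (f i) (((|C| + 1) / ‖v‖) • v) = 0 := by
        have := h0 i
        simp only [recFn] at this ⊢
        rw [aux_hom, this, mul_zero]
      have h2 := hnn i y hy
      simp only [h1] at hi
      linarith
    have := hC _ hmem
    rw [norm_smul, Real.norm_of_nonneg hcpos.le, div_mul_cancel₀ _ hvpos.ne'] at this
    linarith [le_abs_self C]
  set g : (Fin n → ℝ) → ℝ := fun x => ∑ i, evalFn (f i) x with hg
  have hgc : Continuous g :=
    continuous_finsetSum _ fun i _ => MvPolynomial.continuous_eval (f i)
  obtain ⟨x0, hx0⟩ := hK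
  have hbd : Bornology.IsBounded (K ∩ {x | g x ≤ g x0}) := by
    by_contra hnb
    have hex : ∀ k : ℕ, ∃ x ∈ K ∩ {x | g x ≤ g x0}, (k : ℝ) + 1 < ‖x‖ := by
      intro k
      by_contra hcon
      push Not at hcon
      exact hnb (isBounded_iff_forall_norm_le.2 ⟨_, hcon⟩)
    choose x hx hxn using hex
    have hxt : Tendsto (fun k => ‖x k‖) atTop atTop :=
      tendsto_atTop_mono (fun k => by linarith [hxn k]) tendsto_natCast_atTop_atTop
    have hsph : ∀ k, (‖x k‖)⁻¹ • x k ∈ Metric.sphere (0 : Fin n → ℝ) 1 := by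
      intro k
      have : 0 < ‖x k‖ := lt_trans (by positivity) (hxn k)
      rw [mem_sphere_zero_iff_norm, norm_smul, norm_inv, norm_norm, inv_mul_cancel₀ this.ne']
    obtain ⟨v, hv, φ, hφ, hlim⟩ := (isCompact_sphere (0 : Fin n → ℝ) 1).tendsto_subseq hsph
    have ht : Tendsto (fun k => ‖x (φ k)‖) atTop atTop := hxt.comp hφ.tendsto_atTop
    have hvK : v ∈ asympCone K := ⟨fun k => ‖x (φ k)‖, fun k => x (φ k), fun k => (hx _).1, ht, hlim⟩
    have hv0 : v = 0 := by
      refine hzero v hvK fun i => le_antisymm ?_ (hnn i v hvK)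
      have h1 := aux_lim (f i) (fun k => ‖x (φ k)‖) (fun k => x (φ k)) v ht hlim
      have h2 : Tendsto (fun k => (g x0 - ∑ j ∈ Finset.univ.erase i, r j) /
          ‖x (φ k)‖ ^ (f i).totalDegree) atTop (nhds 0) :=
        tendsto_const_nhds.div_atTop
          ((tendsto_pow_atTop (by have := hdeg i; omega)).comp ht)
      refine le_of_tendsto_of_tendsto' h1 h2 fun k => ?_
      have h3 : g (x (φ k)) ≤ g x0 := (hx (φ k)).2
      have h4 : g (x (φ k)) = evalFn (f i) (x (φ k))
          + ∑ j ∈ Finset.univ.erase i, evalFn (f j) (x (φ k)) :=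
        (Finset.add_sum_erase _ _ (Finset.mem_univ i)).symm
      have h5 : ∑ j ∈ Finset.univ.erase i, r j
          ≤ ∑ j ∈ Finset.univ.erase i, evalFn (f j) (x (φ k)) :=
        Finset.sum_le_sum fun j _ => hr _ (hx _).1 j
      have h6 : evalFn (f i) (x (φ k)) ≤ g x0 - ∑ j ∈ Finset.univ.erase i, r j := by linarith
      exact div_le_div_of_nonneg_right h6 (by positivity)
    rw [hv0, mem_sphere_zero_iff_norm, norm_zero] at hv
    exact zero_ne_one hv
  have hcpt : IsCompact (K ∩ {x | g x ≤ g x0}) :=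
    Metric.isCompact_of_isClosed_isBounded
      (hKc.inter (isClosed_le hgc continuous_const)) hbd
  obtain ⟨z, hz, hmin⟩ := hcpt.exists_isMinOn ⟨x0, hx0, le_refl (g x0)⟩ hgc.continuousOn
  refine ⟨z, hz.1, ?_⟩
  rintro y hy ⟨hle, i, hi⟩
  have hlt : g y < g z := Finset.sum_lt_sum (fun i _ => hle i) ⟨i, Finset.mem_univ i, hi⟩
  have hz2 : g z ≤ g x0 := hz.2
  have := isMinOn_iff.1 hmin y ⟨hy, (hlt.le.trans hz2)⟩
  linarith
end

section
/- If SOL(K_∞, f_i^∞) = {0} for every i ∈ {1, …, s}, then the Pareto efficient solution set SOL^s(K, f) is nonempty and the weak Pareto efficient solution set SOL^w(K, f) is bounded. -/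
open Filter Topology MvPolynomial

lemma eval_smul_hom_s15 {n : ℕ} (p : MvPolynomial (Fin n) ℝ) (j : ℕ) (r : ℝ) (u : Fin n → ℝ) :
    eval (r • u) (homogeneousComponent j p) = r ^ j * eval u (homogeneousComponent j p) := by
  have hh := homogeneousComponent_isHomogeneous j p
  rw [eval_eq, eval_eq, Finset.mul_sum]
  refine Finset.sum_congr rfl fun d hd => ?_
  have hd' : d.degree = j := by
    have := hh (mem_support_iff.mp hd)
    rw [Finsupp.degree_eq_weight_one]; exact this
  have : ∏ i ∈ d.support, (r • u) i ^ d i = r ^ j * ∏ i ∈ d.support, u i ^ d i := by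
    simp only [Pi.smul_apply, smul_eq_mul, mul_pow, Finset.prod_mul_distrib]
    rw [Finset.prod_pow_eq_pow_sum]
    rw [← hd']
    rfl
  rw [this]; ring

/-- The key scaling identity. -/
lemma scale_eval {n : ℕ} (p : MvPolynomial (Fin n) ℝ) (r : ℝ) (hr : r ≠ 0) (x : Fin n → ℝ) :
    ∑ j ∈ Finset.range (p.totalDegree + 1),
      r ^ (p.totalDegree - j) * eval (r • x) (homogeneousComponent j p) =
    r ^ p.totalDegree * eval x p := by
  have he : eval x p = ∑ j ∈ Finset.range (p.totalDegree + 1),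
      eval x (homogeneousComponent j p) := by
    rw [← map_sum, sum_homogeneousComponent]
  rw [he, Finset.mul_sum]
  refine Finset.sum_congr rfl fun j hj => ?_
  rw [eval_smul_hom_s15, ← mul_assoc, ← pow_add]
  congr 2
  have := Finset.mem_range.mp hj
  omega

theorem stmt15 {n s : ℕ} (hs : 0 < s) (K : Set (Fin n → ℝ)) (hK : K.Nonempty) (hKc : IsClosed K)
    (f : Fin s → MvPolynomial (Fin n) ℝ) (hdeg : ∀ i, 1 ≤ (f i).totalDegree)
    (h : ∀ i, SOLmin (asympCone K) (recFn (f i)) = {0}) :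
    (SOLs K (fun i => evalFn (f i))).Nonempty ∧ Bornology.IsBounded (SOLw K (fun i => evalFn (f i))) := by
  obtain ⟨x0, hx0⟩ := hK
  have hb : ∀ i, Bornology.IsBounded {x | x ∈ K ∧ evalFn (f i) x ≤ evalFn (f i) x0} :=
    fun i => sublevel_bounded K (f i) (hdeg i) (h i) _
  have hcont : ∀ i, Continuous (evalFn (f i)) := fun i => MvPolynomial.continuous_eval _
  constructor
  · let S : Set (Fin n → ℝ) := {x | x ∈ K ∧ ∀ i, evalFn (f i) x ≤ evalFn (f i) x0}
    have hSb : Bornology.IsBounded S := (hb ⟨0, hs⟩).subset fun x hx => ⟨hx.1, hx.2 _⟩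
    have hSc : IsClosed S := by
      have : S = K ∩ ⋂ i, {x | evalFn (f i) x ≤ evalFn (f i) x0} := by
        ext x; simp [S]
      rw [this]
      exact hKc.inter (isClosed_iInter fun i => isClosed_le (hcont i) continuous_const)
    have hScomp : IsCompact S := Metric.isCompact_of_isClosed_isBounded hSc hSb
    obtain ⟨x, hxS, hmin⟩ := hScomp.exists_isMinOn ⟨x0, hx0, fun i => le_rfl⟩
      (continuous_finsetSum Finset.univ fun i _ => hcont i).continuousOn
    refine ⟨x, hxS.1, ?_⟩
    rintro y hy ⟨hle, i, hi⟩
    have h1 := hmin (show y ∈ S from ⟨hy, fun i => (hle i).trans (hxS.2 i)⟩)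
    have h2 : ∑ i, evalFn (f i) y < ∑ i, evalFn (f i) x :=
      Finset.sum_lt_sum (fun i _ => hle i) ⟨i, Finset.mem_univ _, hi⟩
    exact absurd h1 (not_le.mpr h2)
  · refine ((Bornology.isBounded_iUnion).mpr hb).subset ?_
    rintro x ⟨hxK, hx⟩
    have := hx x0 hx0
    push Not at this
    obtain ⟨i, hi⟩ := this
    exact Set.mem_iUnion.mpr ⟨i, hxK, hi⟩
end

section
/- Suppose SOL^s(K_∞, f^∞) = {0}. Then for every vector polynomial g = (g_1, …, g_s) : ℝ^n → ℝ^s with deg g_i < deg f_i for all i ∈ {1, …, s}, the Pareto efficient solution set SOL^s(K, f + g) is nonempty. -/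
open Filter Topology MvPolynomial

theorem aux_eval_smul {n m : ℕ} {p : MvPolynomial (Fin n) ℝ} (hp : p.IsHomogeneous m)
    (c : ℝ) (x : Fin n → ℝ) : eval (c • x) p = c ^ m * eval x p := by
  rw [eval_eq', eval_eq', Finset.mul_sum]
  refine Finset.sum_congr rfl fun d hd => ?_
  have h1 : ∑ i, d i = m := by
    have h2 := hp (mem_support_iff.mp hd)
    rw [Finsupp.weight_apply, Finsupp.sum_fintype _ _ (by simp)] at h2
    simpa using h2
  simp only [Pi.smul_apply, smul_eq_mul, mul_pow, Finset.prod_mul_distrib,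
    Finset.prod_pow_eq_pow_sum, h1]
  ring

theorem aux_eval_eq {n d : ℕ} (p : MvPolynomial (Fin n) ℝ) (hp : p.totalDegree ≤ d)
    (x : Fin n → ℝ) :
    eval x p = ∑ i ∈ Finset.range (d + 1), eval x (homogeneousComponent i p) := by
  rw [← map_sum]
  congr 1
  conv_lhs => rw [← sum_homogeneousComponent p]
  refine Finset.sum_subset (Finset.range_mono (by omega)) fun i _ hi => ?_
  apply homogeneousComponent_eq_zero
  simp at hi
  omega

theorem aux_tendsto {n d : ℕ} (p : MvPolynomial (Fin n) ℝ) (hp : p.totalDegree ≤ d)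
    (t : ℕ → ℝ) (x : ℕ → Fin n → ℝ) (v : Fin n → ℝ) (ht : Tendsto t atTop atTop)
    (hx : Tendsto (fun k => (t k)⁻¹ • x k) atTop (nhds v)) :
    Tendsto (fun k => ((t k)⁻¹) ^ d * eval (x k) p) atTop
      (nhds (eval v (homogeneousComponent d p))) := by
  have hinv : Tendsto (fun k => (t k)⁻¹) atTop (nhds 0) := tendsto_inv_atTop_zero.comp ht
  have hc : ∀ i, Tendsto (fun k => eval ((t k)⁻¹ • x k) (homogeneousComponent i p)) atTop
      (nhds (eval v (homogeneousComponent i p))) := fun i =>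
    ((MvPolynomial.continuous_eval (homogeneousComponent i p)).tendsto v).comp hx
  have key : Tendsto (fun k => ∑ i ∈ Finset.range (d + 1),
      ((t k)⁻¹) ^ (d - i) * eval ((t k)⁻¹ • x k) (homogeneousComponent i p)) atTop
      (nhds (∑ i ∈ Finset.range (d + 1),
        (0 : ℝ) ^ (d - i) * eval v (homogeneousComponent i p))) :=
    tendsto_finsetSum _ fun i _ => (hinv.pow _).mul (hc i)
  have hlim : ∑ i ∈ Finset.range (d + 1), (0 : ℝ) ^ (d - i) * eval v (homogeneousComponent i p)
      = eval v (homogeneousComponent d p) := by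
    rw [Finset.sum_range_succ, Finset.sum_eq_zero]
    · simp
    · intro i hi
      have : d - i ≠ 0 := by simp at hi; omega
      simp [this]
  rw [hlim] at key
  refine key.congr fun k => ?_
  rw [aux_eval_eq p hp (x k), Finset.mul_sum]
  refine Finset.sum_congr rfl fun i hi => ?_
  rw [aux_eval_smul (homogeneousComponent_isHomogeneous i p), ← mul_assoc, ← pow_add]
  congr 2
  simp at hi
  omega

theorem stmt17 {n s : ℕ} (hs : 0 < s) (K : Set (Fin n → ℝ)) (hK : K.Nonempty) (hKc : IsClosed K)
    (f : Fin s → MvPolynomial (Fin n) ℝ) (hdeg : ∀ i, 1 ≤ (f i).totalDegree)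
    (h : SOLs (asympCone K) (fun i => recFn (f i)) = {0})
    (g : Fin s → MvPolynomial (Fin n) ℝ)
    (hg : ∀ i, (g i).totalDegree < (f i).totalDegree) :
    (SOLs K (fun i => evalFn (f i + g i))).Nonempty := by
  have hpos : ∀ v ∈ asympCone K, v ≠ 0 → ∃ i, 0 < recFn (f i) v := by
    intro v hv hv0
    by_contra! hcon
    have h0 : ∀ i, recFn (f i) 0 = 0 := by
      intro i
      have := aux_eval_smul (homogeneousComponent_isHomogeneous (f i).totalDegree (f i)) 0 0
      have hd : (f i).totalDegree ≠ 0 := by have := hdeg i; omega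
      simpa [recFn, hd] using this
    have hmem : (0 : Fin n → ℝ) ∈ SOLs (asympCone K) (fun i => recFn (f i)) := by
      rw [h]; rfl
    have hall : ∀ i, recFn (f i) v = 0 := by
      intro i
      by_contra hne
      exact hmem.2 v hv ⟨fun j => by simpa [h0] using hcon j,
        i, by simpa [h0] using lt_of_le_of_ne (hcon i) hne⟩
    have hvm : v ∈ SOLs (asympCone K) (fun i => recFn (f i)) := by
      refine ⟨hv, fun y hy hy' => hmem.2 y hy ?_⟩
      simpa [h0, hall] using hy'
    rw [h] at hvm
    exact hv0 hvm
  obtain ⟨x0, hx0⟩ := hK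
  set q : Fin s → (Fin n → ℝ) → ℝ := fun i => evalFn (f i + g i) with hq
  have hqc : ∀ i, Continuous (q i) := fun i => MvPolynomial.continuous_eval (f i + g i)
  set S : Set (Fin n → ℝ) := K ∩ {x | ∀ i, q i x ≤ q i x0} with hS
  have hSc : IsClosed S := by
    refine hKc.inter ?_
    rw [Set.setOf_forall]
    exact isClosed_iInter fun i => isClosed_le (hqc i) continuous_const
  have hSb : Bornology.IsBounded S := by
    by_contra hnb
    have hex : ∀ k : ℕ, ∃ x ∈ S, (k : ℝ) + 1 < ‖x‖ := by
      intro k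
      by_contra! hcon
      exact hnb (isBounded_iff_forall_norm_le.mpr ⟨_, hcon⟩)
    choose x hxS hxn using hex
    have hxpos : ∀ k, 0 < ‖x k‖ := fun k => lt_trans (by positivity) (hxn k)
    have hsph : ∀ k, ‖x k‖⁻¹ • x k ∈ Metric.sphere (0 : Fin n → ℝ) 1 := by
      intro k
      rw [mem_sphere_zero_iff_norm, norm_smul, norm_inv, norm_norm,
        inv_mul_cancel₀ (hxpos k).ne']
    obtain ⟨v, hv, φ, hφ, hlim⟩ := (isCompact_sphere (0 : Fin n → ℝ) 1).tendsto_subseq hsph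
    have ht : Tendsto (fun k => ‖x k‖) atTop atTop :=
      tendsto_atTop_mono (fun k => by linarith [hxn k]) tendsto_natCast_atTop_atTop
    have ht' : Tendsto (fun k => ‖x (φ k)‖) atTop atTop := ht.comp hφ.tendsto_atTop
    have hv0 : v ≠ 0 := by
      rintro rfl
      simp at hv
    obtain ⟨i, hi⟩ := hpos v
      ⟨fun k => ‖x (φ k)‖, fun k => x (φ k), fun k => (hxS _).1, ht', hlim⟩ hv0
    have hT := aux_tendsto (d := (f i).totalDegree) (f i + g i)
      ((totalDegree_add _ _).trans (max_le le_rfl (hg i).le)) _ _ v ht' hlim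
    rw [map_add, homogeneousComponent_eq_zero _ (g i) (hg i), add_zero] at hT
    have hU : Tendsto (fun k => (‖x (φ k)‖⁻¹) ^ (f i).totalDegree * q i x0) atTop (nhds 0) := by
      have h1 := ((tendsto_inv_atTop_zero.comp ht').pow (f i).totalDegree).mul_const (q i x0)
      have hd : (f i).totalDegree ≠ 0 := by have := hdeg i; omega
      simpa [hd] using h1
    have hle := le_of_tendsto_of_tendsto' hT hU fun k =>
      mul_le_mul_of_nonneg_left ((hxS (φ k)).2 i) (by positivity)
    exact absurd hle (not_le.mpr hi)
  have hScomp : IsCompact S := Metric.isCompact_of_isClosed_isBounded hSc hSb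
  obtain ⟨z, hz, hmin⟩ := hScomp.exists_isMinOn ⟨x0, hx0, fun i => le_rfl⟩
    (f := fun x => ∑ i, q i x) (continuous_finsetSum _ fun i _ => hqc i).continuousOn
  refine ⟨z, hz.1, ?_⟩
  rintro y hy ⟨hle, i, hlt⟩
  have h1 : ∑ i, q i z ≤ ∑ i, q i y := hmin ⟨hy, fun j => (hle j).trans (hz.2 j)⟩
  have h2 : ∑ i, q i y < ∑ i, q i z :=
    Finset.sum_lt_sum (fun j _ => hle j) ⟨i, Finset.mem_univ i, hlt⟩
  exact absurd h1 (not_le.mpr h2)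
end
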